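/- There exist sets X, Y, Z and open Petri nets P : X ↛ Y and Q : Y ↛ Z such that the composite relation ■Q ∘ ■P = {(x, z) : ∃ y ∈ ℕ[Y], (x, y) ∈ ■P and (y, z) ∈ ■Q} is a proper subset of ■(Q ⊙ P); that is, the reachability semantics is lax but not strict on composition. -/

import Mathlib

universe u

structure PetriNet : Type (u + 1) where
  T : Type u
  S : Type u
  src : T → Multiset S
  tgt : T → Multiset S

def PetriNet.Fires (P : PetriNet.{u}) (τ : P.T) (m n : Multiset P.S) : Prop :=
  P.src τ ≤ m ∧ n + P.src τ = m + P.tgt τ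

inductive PetriNet.Reachable (P : PetriNet.{u}) : Multiset P.S → Multiset P.S → Prop
  | refl (m : Multiset P.S) : PetriNet.Reachable P m m
  | step {m m' n : Multiset P.S} (τ : P.T) :
      P.Fires τ m m' → PetriNet.Reachable P m' n → PetriNet.Reachable P m n

/-- An open Petri net `P : X ↛ Y`: a Petri net together with functions from `X` and `Y`
into its set of places. -/
structure OpenPetri (X Y : Type u) : Type (u + 1) where
  net : PetriNet.{u}
  i : X → net.S
  o : Y → net.S

/-- The reachability relation `■P ⊆ ℕ[X] × ℕ[Y]` of an open Petri net. -/
def OpenPetri.bsq {X Y : Type u} (P : OpenPetri X Y) : Set (Multiset X × Multiset Y) :=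
  {p | P.net.Reachable (p.1.map P.i) (p.2.map P.o)}

/-- The pushout `S_P +_Y S_Q` of the places of `P` and `Q` along `Y`. -/
def OpenPetri.Glue {X Y Z : Type u} (P : OpenPetri X Y) (Q : OpenPetri Y Z) : Type u :=
  Quot (fun (a b : P.net.S ⊕ Q.net.S) => ∃ y : Y, a = Sum.inl (P.o y) ∧ b = Sum.inr (Q.i y))

/-- The composite `Q ⊙ P : X ↛ Z` of open Petri nets, formed by gluing the outputs of `P`
to the inputs of `Q` along `Y` (a pushout of the sets of places). -/
def OpenPetri.comp {X Y Z : Type u} (P : OpenPetri X Y) (Q : OpenPetri Y Z) :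
    OpenPetri X Z where
  net :=
    { T := P.net.T ⊕ Q.net.T
      S := P.Glue Q
      src := Sum.elim (fun τ => (P.net.src τ).map (fun s => Quot.mk _ (Sum.inl s)))
        (fun τ => (Q.net.src τ).map (fun s => Quot.mk _ (Sum.inr s)))
      tgt := Sum.elim (fun τ => (P.net.tgt τ).map (fun s => Quot.mk _ (Sum.inl s)))
        (fun τ => (Q.net.tgt τ).map (fun s => Quot.mk _ (Sum.inr s))) }
  i := fun x => Quot.mk _ (Sum.inl (P.i x))
  o := fun z => Quot.mk _ (Sum.inr (Q.o z))


theorem PetriNet.Reachable.trans {P : PetriNet.{u}} {l m n : Multiset P.S}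
    (h : P.Reachable l m) (h' : P.Reachable m n) : P.Reachable l n := by
  induction h with
  | refl => exact h'
  | step τ hτ _ ih => exact .step τ hτ (ih h')

/-- A morphism of Petri nets preserves reachability. -/
theorem PetriNet.Reachable.map {P R : PetriNet.{u}} (g : P.T → R.T) (f : P.S → R.S)
    (hsrc : ∀ τ, R.src (g τ) = (P.src τ).map f) (htgt : ∀ τ, R.tgt (g τ) = (P.tgt τ).map f)
    {m n : Multiset P.S} (h : P.Reachable m n) : R.Reachable (m.map f) (n.map f) := by
  induction h with
  | refl => exact .refl _
  | step τ hτ _ ih =>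
    refine .step (g τ) ⟨?_, ?_⟩ ih
    · rw [hsrc]
      exact Multiset.map_le_map hτ.1
    · rw [hsrc, htgt, ← Multiset.map_add, ← Multiset.map_add, hτ.2]

/-- A property of markings preserved by every firing is preserved by reachability. -/
theorem PetriNet.Reachable.invariant {P : PetriNet.{u}} {p : Multiset P.S → Prop}
    (hp : ∀ τ m n, P.Fires τ m n → p m → p n) {m n : Multiset P.S}
    (h : P.Reachable m n) (hm : p m) : p n := by
  induction h with
  | refl => exact hm
  | step τ hτ _ ih => exact ih (hp _ _ _ hτ hm)

/-- The reachability semantics is lax on composition. -/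
theorem OpenPetri.bsq_comp_subset {X Y Z : Type u} (P : OpenPetri X Y) (Q : OpenPetri Y Z) :
    {p : Multiset X × Multiset Z |
        ∃ y : Multiset Y, (p.1, y) ∈ P.bsq ∧ (y, p.2) ∈ Q.bsq} ⊆ (P.comp Q).bsq := by
  rintro ⟨x, z⟩ ⟨y, hP, hQ⟩
  have h₁ := PetriNet.Reachable.map (R := (P.comp Q).net) Sum.inl
    (fun s => Quot.mk _ (Sum.inl s)) (fun _ => rfl) (fun _ => rfl) hP
  have h₂ := PetriNet.Reachable.map (R := (P.comp Q).net) Sum.inr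
    (fun s => Quot.mk _ (Sum.inr s)) (fun _ => rfl) (fun _ => rfl) hQ
  have hglue : (y.map P.o).map (fun s => (Quot.mk _ (Sum.inl s) : P.Glue Q)) =
      (y.map Q.i).map (fun s => Quot.mk _ (Sum.inr s)) := by
    rw [Multiset.map_map, Multiset.map_map]
    exact Multiset.map_congr rfl fun y _ => Quot.sound ⟨y, rfl, rfl⟩
  have hx : (x.map P.i).map (fun s => (Quot.mk _ (Sum.inl s) : P.Glue Q)) =
      x.map (P.comp Q).i := Multiset.map_map _ _ _
  have hz : (z.map Q.o).map (fun s => (Quot.mk _ (Sum.inr s) : P.Glue Q)) =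
      z.map (P.comp Q).o := Multiset.map_map _ _ _
  change (P.comp Q).net.Reachable (x.map (P.comp Q).i) (z.map (P.comp Q).o)
  rw [← hx, ← hz]
  exact h₁.trans (hglue ▸ h₂)

/-- The open Petri net with one place and one transition, which consumes `a` tokens and
produces `b` tokens. -/
def OpenPetri.single (a b : ℕ) : OpenPetri PUnit.{u + 1} PUnit.{u + 1} where
  net :=
    { T := PUnit
      S := PUnit
      src := fun _ => Multiset.replicate a PUnit.unit
      tgt := fun _ => Multiset.replicate b PUnit.unit }
  i := id
  o := id

theorem OpenPetri.card_of_fires_single {a b : ℕ} {τ : (single.{u} a b).net.T}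
    {m n : Multiset (single.{u} a b).net.S} (h : (single a b).net.Fires τ m n) :
    a ≤ m.card ∧ n.card + a = m.card + b := by
  have h₁ := Multiset.card_le_card h.1
  have h₂ := congrArg Multiset.card h.2
  rw [Multiset.card_add, Multiset.card_add] at h₂
  have hs : Multiset.card ((single.{u} a b).net.src τ) = a := Multiset.card_replicate _ _
  have ht : Multiset.card ((single.{u} a b).net.tgt τ) = b := Multiset.card_replicate _ _
  rw [hs] at h₁ h₂
  rw [ht] at h₂
  exact ⟨h₁, h₂⟩

/-- There exist sets `X, Y, Z` and open Petri nets `P : X ↛ Y`,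
`Q : Y ↛ Z` such that the composite relation `■Q ∘ ■P` is a *proper* subset of
`■(Q ⊙ P)`: the reachability semantics is lax but not strict on composition. -/
theorem bsq_comp_proper : ∃ (X Y Z : Type u) (P : OpenPetri X Y) (Q : OpenPetri Y Z),
    {p : Multiset X × Multiset Z |
        ∃ y : Multiset Y, (p.1, y) ∈ P.bsq ∧ (y, p.2) ∈ Q.bsq} ⊂ (P.comp Q).bsq := by
  refine ⟨PUnit, PUnit, PUnit, .single 2 0, .single 1 2,
    OpenPetri.bsq_comp_subset _ _, fun hsub => ?_⟩
  have hmem : (({PUnit.unit}, 0) : Multiset PUnit.{u + 1} × Multiset PUnit.{u + 1}) ∈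
      ((OpenPetri.single 2 0).comp (OpenPetri.single 1 2)).bsq := by
    have hglue : (Quot.mk _ (Sum.inl PUnit.unit) :
        (OpenPetri.single.{u} 2 0).Glue (.single.{u} 1 2)) = Quot.mk _ (Sum.inr PUnit.unit) :=
      Quot.sound ⟨PUnit.unit, rfl, rfl⟩
    refine PetriNet.Reachable.step (m' := Multiset.replicate 2 (Quot.mk _ (Sum.inl PUnit.unit)))
      (Sum.inr PUnit.unit) ⟨?_, ?_⟩ (.step (m' := 0) (Sum.inl PUnit.unit) ⟨?_, ?_⟩ (.refl _))
    · exact (congrArg (fun s => ({s} : Multiset _)) hglue).ge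
    · have replicate_add_singleton {α : Type u} {a b : α} (h : a = b) :
          Multiset.replicate 2 a + {b} = {a} + Multiset.replicate 2 b := by rw [h, add_comm]
      exact replicate_add_singleton hglue
    · exact le_rfl
    · exact add_comm _ _
  obtain ⟨y, hP, hQ⟩ := hsub hmem
  have hy : (y.map (OpenPetri.single.{u} 2 0).o).card = 1 :=
    PetriNet.Reachable.invariant (p := fun m => m.card = 1)
      (fun τ m n h hm => by have := OpenPetri.card_of_fires_single h; omega) hP rfl
  have hz : 0 < Multiset.card ((0 : Multiset PUnit).map (OpenPetri.single.{u} 1 2).o) :=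
    PetriNet.Reachable.invariant (p := fun m => 0 < m.card)
      (fun τ m n h hm => by have := OpenPetri.card_of_fires_single h; omega) hQ
      (by rw [Multiset.card_map] at hy ⊢; exact hy.symm ▸ Nat.one_pos)
  exact absurd hz (lt_irrefl 0)
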